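/- Let L and M be the kernels of the inflation maps H²(H/A, D) → H²(H/Z, D) and H²(K/A, D) → H²(K/Z, D) respectively; then L ≅ Hom((A ∩ [H,H])/Z, D) and M ≅ Hom((A ∩ [K,K])/Z, D), and there is a subgroup N of (H²(H/A, D)/L) ⊕ (H²(K/A, D)/M) with N ≅ Hom(Z, D) such that the group ((H²(H/A, D)/L ⊕ H²(K/A, D)/M)/N) ⊕ Hom(H/A ⊗ K/A, D) embeds into H²(G, D). -/

import Mathlib

/-!
Setting (central products): `G` is a group with normal subgroups `H` and `K` such that
`G = HK` (i.e. `H ⊔ K = ⊤`) and `[H, K] = 1` (i.e. every element of `H` commutes with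
every element of `K`).  We set `A = H ⊓ K` and `Z = ⁅H,H⁆ ⊓ ⁅K,K⁆`; both are central
in `G`.  Coefficients are taken in a divisible abelian group `D`, regarded as a trivial
module.  Second cohomology `H2 X D` is realized concretely as (inhomogeneous)
2-cocycles modulo 2-coboundaries, and `Hom(X, D)` is realized as `Additive X →+ D`.
-/

open scoped TensorProduct

set_option maxHeartbeats 1000000
set_option synthInstance.maxHeartbeats 1000000
set_option synthInstance.maxSize 2000

namespace SchurCP

variable (G : Type) [Group G] (D : Type) [AddCommGroup D]

/-- The group of 2-cocycles on `G` with values in the trivial module `D`. -/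
def cocycles2 : AddSubgroup (G → G → D) where
  carrier := {f | ∀ g h k : G, f g h + f (g * h) k = f h k + f g (h * k)}
  zero_mem' := by intro g h k; simp
  add_mem' := by
    intro a b ha hb g h k
    simp only [Pi.add_apply]
    rw [add_add_add_comm, ha g h k, hb g h k, add_add_add_comm]
  neg_mem' := by
    intro a ha g h k
    simp only [Pi.neg_apply]
    rw [← neg_add, ← neg_add, ha g h k]

/-- The group of 2-coboundaries on `G` with values in the trivial module `D`. -/
def coboundaries2 : AddSubgroup (G → G → D) where
  carrier := {f | ∃ φ : G → D, ∀ g h : G, f g h = φ g + φ h - φ (g * h)}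
  zero_mem' := ⟨0, by simp⟩
  add_mem' := by
    rintro a b ⟨φ, hφ⟩ ⟨ψ, hψ⟩
    exact ⟨φ + ψ, fun g h => by simp only [Pi.add_apply, hφ g h, hψ g h]; abel⟩
  neg_mem' := by
    rintro a ⟨φ, hφ⟩
    exact ⟨-φ, fun g h => by simp only [Pi.neg_apply, hφ g h]; abel⟩

/-- The second cohomology group `H²(G, D)` of `G` with coefficients in the
trivial module `D`. -/
def H2 : Type := cocycles2 G D ⧸ (coboundaries2 G D).addSubgroupOf (cocycles2 G D)

instance : AddCommGroup (H2 G D) :=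
  QuotientAddGroup.Quotient.addCommGroup ((coboundaries2 G D).addSubgroupOf (cocycles2 G D))

variable {G D}

/-- The cohomology class of a 2-cocycle. -/
abbrev H2mk (f : cocycles2 G D) : H2 G D := QuotientAddGroup.mk f

/-- Pullback of a 2-cocycle along a group homomorphism. -/
def pullCocycle {G' : Type} [Group G'] (π : G' →* G) :
    cocycles2 G D →+ cocycles2 G' D where
  toFun f := ⟨fun x y => (f : G → G → D) (π x) (π y), by
    intro x y z
    simpa only [map_mul] using f.2 (π x) (π y) (π z)⟩
  map_zero' := rfl
  map_add' _ _ := rfl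

/-- The homomorphism `H²(G, D) → H²(G', D)` induced by a group homomorphism
`π : G' → G`; this specializes to restriction maps (for inclusions of subgroups)
and to inflation maps (for quotient maps). -/
def H2Map {G' : Type} [Group G'] (π : G' →* G) : H2 G D →+ H2 G' D :=
  QuotientAddGroup.map _ _ (pullCocycle π) (by
    intro f hf
    rw [AddSubgroup.mem_addSubgroupOf] at hf
    rw [AddSubgroup.mem_comap, AddSubgroup.mem_addSubgroupOf]
    obtain ⟨φ, hφ⟩ := hf
    exact ⟨fun x => φ (π x), fun x y => by
      show (f : G → G → D) (π x) (π y) = _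
      rw [hφ (π x) (π y), ← map_mul]⟩)

theorem commutator_le_self {X : Type} [Group X] (H : Subgroup X) : ⁅H, H⁆ ≤ H := by
  rw [Subgroup.commutator_le]
  intro g₁ h₁ g₂ h₂
  rw [commutatorElement_def]
  exact H.mul_mem (H.mul_mem (H.mul_mem h₁ h₂) (H.inv_mem h₁)) (H.inv_mem h₂)

theorem inf_commutator_le_inf {X : Type} [Group X] (H K : Subgroup X) :
    ⁅H, H⁆ ⊓ ⁅K, K⁆ ≤ H ⊓ K :=
  inf_le_inf (commutator_le_self H) (commutator_le_self K)

theorem subgroupOf_le {X : Type} [Group X] {B C : Subgroup X} (h : B ≤ C)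
    (J : Subgroup X) : B.subgroupOf J ≤ C.subgroupOf J := fun _x hx => h hx

/-- The natural projection `X/N → X/M` for `N ≤ M`. -/
def quotProj {X : Type} [Group X] {N M : Subgroup X} [N.Normal] [M.Normal] (h : N ≤ M) :
    (X ⧸ N) →* (X ⧸ M) :=
  QuotientGroup.map N M (MonoidHom.id X) (by rwa [Subgroup.comap_id])

/-- The inflation homomorphism `H²(X/M, D) → H²(X/N, D)` for `N ≤ M`. -/
def inflMap {X : Type} [Group X] {N M : Subgroup X} [N.Normal] [M.Normal]
    (h : N ≤ M) (D : Type) [AddCommGroup D] : H2 (X ⧸ M) D →+ H2 (X ⧸ N) D :=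
  H2Map (quotProj h)

/-- The natural homomorphism `H/(A ∩ H) → X/A` for subgroups `A, H` of `X`;
for `A ≤ H` this realizes `H/A` as a subgroup of `X/A`. -/
def quotInclusion {X : Type} [Group X] (H A : Subgroup X) [A.Normal]
    [(A.subgroupOf H).Normal] : (↥H ⧸ A.subgroupOf H) →* X ⧸ A :=
  QuotientGroup.map (A.subgroupOf H) A H.subtype (fun _x hx => hx)

/-- The abelian tensor product `X ⊗ Y = X/[X,X] ⊗_ℤ Y/[Y,Y]` of two groups. -/
abbrev AbTensor (X Y : Type) [Group X] [Group Y] : Type :=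
  TensorProduct ℤ (Additive (Abelianization X)) (Additive (Abelianization Y))

/-- The element `x[X,X] ⊗ y[Y,Y]` of the abelian tensor product. -/
noncomputable abbrev tmulAb {X Y : Type} [Group X] [Group Y] (x : X) (y : Y) :
    AbTensor X Y :=
  Additive.ofMul (Abelianization.of x) ⊗ₜ[ℤ] Additive.ofMul (Abelianization.of y)

/-- The map on abelian tensor products induced by a pair of group homomorphisms. -/
noncomputable def abTensorMap {X Y X' Y' : Type} [Group X] [Group Y] [Group X'] [Group Y']
    (f : X →* X') (g : Y →* Y') : AbTensor X Y →ₗ[ℤ] AbTensor X' Y' :=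
  TensorProduct.map (MonoidHom.toAdditive (Abelianization.map f)).toIntLinearMap
    (MonoidHom.toAdditive (Abelianization.map g)).toIntLinearMap

theorem H2mk_surjective {Q : Type} [Group Q] {D : Type} [AddCommGroup D] :
    Function.Surjective (H2mk : cocycles2 Q D → H2 Q D) :=
  QuotientAddGroup.mk_surjective

theorem H2mk_eq_zero_iff {Q : Type} [Group Q] {D : Type} [AddCommGroup D]
    {f : cocycles2 Q D} :
    H2mk f = 0 ↔ ∃ φ : Q → D, ∀ x y : Q, (f : Q → Q → D) x y = φ x + φ y - φ (x * y) :=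
  (QuotientAddGroup.eq_zero_iff f).trans AddSubgroup.mem_addSubgroupOf

theorem cocycle_one_left {Q : Type} [Group Q] {D : Type} [AddCommGroup D]
    (f : cocycles2 Q D) (x : Q) : (f : Q → Q → D) 1 x = (f : Q → Q → D) 1 1 := by
  have h := f.2 1 1 x
  simp only [one_mul] at h
  exact (add_right_cancel (h.trans (add_comm _ _ ))).symm

theorem cocycle_one_right {Q : Type} [Group Q] {D : Type} [AddCommGroup D]
    (f : cocycles2 Q D) (x : Q) : (f : Q → Q → D) x 1 = (f : Q → Q → D) 1 1 := by
  have h := f.2 x 1 1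
  simp only [mul_one] at h
  exact add_right_cancel h

/-- Homomorphisms with equal kernels, the first one surjective: the second one factors through
the first one by an injection. -/
theorem exists_injective_comp_eq {W V U : Type*} [AddCommGroup W] [AddCommGroup V]
    [AddCommGroup U] (p : W →+ V) (hp : Function.Surjective p) (q : W →+ U)
    (hker : ∀ w, p w = 0 ↔ q w = 0) :
    ∃ ι : V →+ U, Function.Injective ι ∧ ∀ w, ι (p w) = q w := by
  have hle : p.ker ≤ q.ker := fun w hw => (hker w).1 hw
  have hι : ∀ w, p.liftOfSurjective hp ⟨q, hle⟩ (p w) = q w := fun w =>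
    p.liftOfRightInverse_comp_apply _ (Function.rightInverse_surjInv hp) ⟨q, hle⟩ w
  refine ⟨p.liftOfSurjective hp ⟨q, hle⟩, ?_, hι⟩
  rw [injective_iff_map_eq_zero]
  intro v hv
  obtain ⟨w, rfl⟩ := hp v
  rw [hι] at hv
  exact (hker w).2 hv

theorem nonempty_addEquiv_of_ker_eq {W V U : Type*} [AddCommGroup W] [AddCommGroup V]
    [AddCommGroup U] (p : W →+ V) (hp : Function.Surjective p) (q : W →+ U)
    (hq : Function.Surjective q) (hker : ∀ w, p w = 0 ↔ q w = 0) : Nonempty (V ≃+ U) := by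
  obtain ⟨ι, hinj, hι⟩ := exists_injective_comp_eq p hp q hker
  refine ⟨AddEquiv.ofBijective ι ⟨hinj, fun u => ?_⟩⟩
  obtain ⟨w, rfl⟩ := hq u
  exact ⟨p w, hι w⟩

/-- Characters with values in a divisible group extend along `f : X → Y` as soon as they
vanish on the preimage of the commutator subgroup. -/
theorem exists_character_extension {X Y : Type*} [Group X] [Group Y] {D : Type}
    [AddCommGroup D] [DivisibleBy D ℤ] (f : X →* Y) (χ : Additive X →+ D)
    (h : ∀ x, f x ∈ commutator Y → χ (Additive.ofMul x) = 0) :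
    ∃ ψ : Additive Y →+ D, ∀ x, ψ (Additive.ofMul (f x)) = χ (Additive.ofMul x) := by
  let F : Additive X →+ Additive (Abelianization Y) :=
    MonoidHom.toAdditive (Abelianization.of.comp f)
  have hle : F.rangeRestrict.ker ≤ χ.ker := by
    intro x hx
    refine h x.toMul ?_
    rw [AddMonoidHom.ker_rangeRestrict] at hx
    rw [← Abelianization.ker_of Y]
    exact hx
  let χ' := F.rangeRestrict.liftOfSurjective F.rangeRestrict_surjective ⟨χ, hle⟩
  have hχ' : ∀ x, χ' (F.rangeRestrict x) = χ x := fun x =>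
    F.rangeRestrict.liftOfRightInverse_comp_apply _
      (Function.rightInverse_surjInv F.rangeRestrict_surjective) ⟨χ, hle⟩ x
  obtain ⟨ψ, hψ⟩ := (Module.Baer.of_divisible D).extension_property_addMonoidHom
    F.range.subtype F.range.subtype_injective χ'
  refine ⟨ψ.comp (MonoidHom.toAdditive Abelianization.of), fun x => ?_⟩
  rw [← hχ']
  exact DFunLike.congr_fun hψ (F.rangeRestrict (Additive.ofMul x))

/-- `B → X → Q` is a central extension of groups. -/
structure IsCentralExtension {B X Q : Type*} [Group B] [Group X] [Group Q]
    (i : B →* X) (π : X →* Q) : Prop where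
  injective : Function.Injective i
  surjective : Function.Surjective π
  map_eq_one_iff : ∀ x, π x = 1 ↔ ∃ b, i b = x
  central : ∀ b x, i b * x = x * i b

/-- The class `a ∈ H²(Q, D)` is, up to sign, the transgression of the character `χ` of the kernel
of `π : X → Q`. -/
def IsTransgression {B X Q D : Type} [Group B] [Group X] [Group Q] [AddCommGroup D]
    (i : B →* X) (π : X →* Q) (χ : Additive B →+ D) (a : H2 Q D) : Prop :=
  ∃ f : cocycles2 Q D, H2mk f = a ∧ ∃ φ : X → D,
    (∀ x y, (f : Q → Q → D) (π x) (π y) = φ x + φ y - φ (x * y)) ∧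
      ∀ b x, φ (i b * x) = χ (Additive.ofMul b) + φ x

namespace IsCentralExtension

variable {B X Q D : Type} [Group B] [Group X] [Group Q] [AddCommGroup D]
  {i : B →* X} {π : X →* Q}

theorem exists_mul_of_eq (h : IsCentralExtension i π) {x y : X} (hxy : π x = π y) :
    ∃ b, x = i b * y := by
  obtain ⟨b, hb⟩ := (h.map_eq_one_iff (x * y⁻¹)).1 (by rw [map_mul, map_inv, hxy, mul_inv_cancel])
  exact ⟨b, by rw [hb, inv_mul_cancel_right]⟩

theorem map_incl (h : IsCentralExtension i π) (b : B) : π (i b) = 1 :=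
  (h.map_eq_one_iff _).2 ⟨b, rfl⟩

theorem exists_isTransgression (h : IsCentralExtension i π) (χ : Additive B →+ D) :
    ∃ a, IsTransgression i π χ a := by
  obtain ⟨s, hs⟩ := h.surjective.hasRightInverse
  have hφ : ∀ x, ∃ b, x = i b * s (π x) := fun x => h.exists_mul_of_eq (hs (π x)).symm
  choose c hc using hφ
  have hmul : ∀ b x, c (i b * x) = b * c x := by
    intro b x
    have hx := hc (i b * x)
    rw [map_mul, h.map_incl, one_mul] at hx
    apply h.injective
    rw [map_mul]
    nth_rewrite 1 [hc x] at hx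
    rw [← mul_assoc] at hx
    exact (mul_right_cancel hx).symm
  let φ : X → D := fun x => χ (Additive.ofMul (c x))
  have hφ : ∀ b x, φ (i b * x) = χ (Additive.ofMul b) + φ x := fun b x => by
    simp only [φ, hmul, ofMul_mul, map_add]
  let f : Q → Q → D := fun x y => φ (s x) + φ (s y) - φ (s x * s y)
  have hf : ∀ x y, f (π x) (π y) = φ x + φ y - φ (x * y) := by
    intro x y
    obtain ⟨b, hb⟩ := h.exists_mul_of_eq (hs (π x)).symm
    obtain ⟨b', hb'⟩ := h.exists_mul_of_eq (hs (π y)).symm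
    have hxy : x * y = i b * (i b' * (s (π x) * s (π y))) := by
      nth_rewrite 1 [hb, hb']
      rw [mul_assoc, ← mul_assoc (s (π x)), ← h.central, mul_assoc]
    have h1 : φ x = χ (Additive.ofMul b) + φ (s (π x)) := by rw [← hφ, ← hb]
    have h2 : φ y = χ (Additive.ofMul b') + φ (s (π y)) := by rw [← hφ, ← hb']
    rw [hxy, hφ, hφ, h1, h2]
    simp only [f]
    abel
  refine ⟨H2mk ⟨f, fun x y z => ?_⟩, _, rfl, φ, hf, hφ⟩
  obtain ⟨x, rfl⟩ := h.surjective x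
  obtain ⟨y, rfl⟩ := h.surjective y
  obtain ⟨z, rfl⟩ := h.surjective z
  simp only [← map_mul, hf, mul_assoc]
  abel

end IsCentralExtension

namespace IsTransgression

variable {B X Q D : Type} [Group B] [Group X] [Group Q] [AddCommGroup D]
  {i : B →* X} {π : X →* Q}

theorem add {χ χ' : Additive B →+ D} {a a' : H2 Q D} (h : IsTransgression i π χ a)
    (h' : IsTransgression i π χ' a') : IsTransgression i π (χ + χ') (a + a') := by
  obtain ⟨f, rfl, φ, hf, hφ⟩ := h
  obtain ⟨f', rfl, φ', hf', hφ'⟩ := h'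
  refine ⟨f + f', rfl, φ + φ', fun x y => ?_, fun b x => ?_⟩
  · simp only [AddSubgroup.coe_add, Pi.add_apply, hf, hf']
    abel
  · simp only [AddMonoidHom.add_apply, Pi.add_apply, hφ, hφ']
    abel

theorem neg {χ : Additive B →+ D} {a : H2 Q D} (h : IsTransgression i π χ a) :
    IsTransgression i π (-χ) (-a) := by
  obtain ⟨f, rfl, φ, hf, hφ⟩ := h
  refine ⟨-f, rfl, -φ, fun x y => ?_, fun b x => ?_⟩
  · simp only [AddSubgroup.coe_neg, Pi.neg_apply, hf]
    abel
  · simp only [AddMonoidHom.neg_apply, Pi.neg_apply, hφ]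
    abel

theorem eq_zero (hc : IsCentralExtension i π) {a : H2 Q D}
    (h : IsTransgression i π (0 : Additive B →+ D) a) : a = 0 := by
  obtain ⟨f, rfl, φ, hf, hφ⟩ := h
  obtain ⟨s, hs⟩ := hc.surjective.hasRightInverse
  have hφs : ∀ x, φ (s (π x)) = φ x := fun x => by
    obtain ⟨b, hb⟩ := hc.exists_mul_of_eq (hs (π x))
    rw [hb, hφ, AddMonoidHom.zero_apply, zero_add]
  refine H2mk_eq_zero_iff.2 ⟨fun x => φ (s x), fun x y => ?_⟩
  obtain ⟨x, rfl⟩ := hc.surjective x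
  obtain ⟨y, rfl⟩ := hc.surjective y
  simp only [← map_mul, hφs, hf]

theorem unique (hc : IsCentralExtension i π) {χ : Additive B →+ D} {a a' : H2 Q D}
    (h : IsTransgression i π χ a) (h' : IsTransgression i π χ a') : a = a' := by
  have := h.add h'.neg
  rw [add_neg_cancel, ← sub_eq_add_neg] at this
  exact sub_eq_zero.1 (this.eq_zero hc)

theorem of_cochain (hc : IsCentralExtension i π) {f : cocycles2 Q D} {φ : X → D}
    (hf : ∀ x y, (f : Q → Q → D) (π x) (π y) = φ x + φ y - φ (x * y)) {χ : Additive B →+ D}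
    (hχ : ∀ b, χ (Additive.ofMul b) = φ (i b) - (f : Q → Q → D) 1 1) :
    IsTransgression i π χ (H2mk f) := by
  refine ⟨f, rfl, φ, hf, fun b x => ?_⟩
  have := hf (i b) x
  rw [hc.map_incl, cocycle_one_left] at this
  rw [hχ, this]
  abel

theorem of_hom (ψ : Additive X →+ D) {χ : Additive B →+ D}
    (hψ : ∀ b, ψ (Additive.ofMul (i b)) = χ (Additive.ofMul b)) :
    IsTransgression i π χ (0 : H2 Q D) := by
  refine ⟨0, rfl, fun x => ψ (Additive.ofMul x), fun x y => ?_, fun b x => ?_⟩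
  · simp
  · simp [hψ]

theorem exists_hom {χ : Additive B →+ D} (h : IsTransgression i π χ (0 : H2 Q D))
    (hc : IsCentralExtension i π) :
    ∃ ψ : Additive X →+ D, ∀ b, ψ (Additive.ofMul (i b)) = χ (Additive.ofMul b) := by
  obtain ⟨f, hf0, φ, hf, hφ⟩ := h
  obtain ⟨θ, hθ⟩ := H2mk_eq_zero_iff.1 hf0
  let ψ : Additive X →+ D := AddMonoidHom.mk' (fun x => φ x.toMul - θ (π x.toMul)) (by
    intro x y
    have h1 := hf x.toMul y.toMul
    rw [hθ, ← map_mul] at h1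
    have h2 : φ (x.toMul * y.toMul) = φ x.toMul + φ y.toMul -
        (θ (π x.toMul) + θ (π y.toMul) - θ (π (x.toMul * y.toMul))) := by
      rw [h1, sub_sub_cancel]
    rw [toMul_add, h2]
    abel)
  refine ⟨ψ, fun b => ?_⟩
  have h1 : φ 1 - θ (π 1) = 0 := ψ.map_zero
  have h2 := hφ b 1
  rw [mul_one] at h2
  change φ (i b) - θ (π (i b)) = _
  rw [hc.map_incl, h2, add_sub_assoc, ← map_one π, h1, add_zero]

end IsTransgression

namespace IsCentralExtension

variable {B X Q D : Type} [Group B] [Group X] [Group Q] [AddCommGroup D]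
  {i : B →* X} {π : X →* Q}

/-- A cochain on `X` whose coboundary is inflated from `Q` restricts, up to normalization, to a
character of the kernel. -/
theorem exists_character_of_cochain (h : IsCentralExtension i π) {f : cocycles2 Q D} {φ : X → D}
    (hf : ∀ x y, (f : Q → Q → D) (π x) (π y) = φ x + φ y - φ (x * y)) :
    ∃ χ : Additive B →+ D, ∀ b, χ (Additive.ofMul b) = φ (i b) - (f : Q → Q → D) 1 1 := by
  refine ⟨AddMonoidHom.mk' (fun b => φ (i b.toMul) - (f : Q → Q → D) 1 1) fun b b' => ?_,
    fun b => rfl⟩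
  have := hf (i b.toMul) (i b'.toMul)
  rw [h.map_incl, h.map_incl] at this
  rw [toMul_add, map_mul, this]
  abel

theorem exists_isTransgression_of_H2Map_eq_zero (h : IsCentralExtension i π) {a : H2 Q D}
    (ha : H2Map π a = 0) : ∃ χ : Additive B →+ D, IsTransgression i π χ a := by
  obtain ⟨f, rfl⟩ := H2mk_surjective a
  obtain ⟨φ, hf⟩ := H2mk_eq_zero_iff.1 (show H2mk (pullCocycle π f) = 0 from ha)
  obtain ⟨χ, hχ⟩ := h.exists_character_of_cochain hf
  exact ⟨χ, .of_cochain h hf hχ⟩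

/-- The (negative of the) transgression homomorphism `Hom(B, D) → H²(Q, D)` of a central
extension. -/
noncomputable def transgression (h : IsCentralExtension i π) (D : Type) [AddCommGroup D] :
    (Additive B →+ D) →+ H2 Q D :=
  AddMonoidHom.mk' (fun χ => (h.exists_isTransgression χ).choose) fun χ χ' =>
    (h.exists_isTransgression (χ + χ')).choose_spec.unique h
      ((h.exists_isTransgression χ).choose_spec.add (h.exists_isTransgression χ').choose_spec)

theorem isTransgression (h : IsCentralExtension i π) (χ : Additive B →+ D) :
    IsTransgression i π χ (h.transgression D χ) :=
  (h.exists_isTransgression χ).choose_spec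

theorem transgression_eq_iff (h : IsCentralExtension i π) {χ : Additive B →+ D} {a : H2 Q D} :
    h.transgression D χ = a ↔ IsTransgression i π χ a :=
  ⟨fun ha => ha ▸ h.isTransgression χ, (h.isTransgression χ).unique h⟩

theorem transgression_eq_zero_iff [DivisibleBy D ℤ] (h : IsCentralExtension i π)
    {χ : Additive B →+ D} :
    h.transgression D χ = 0 ↔ ∀ b, i b ∈ commutator X → χ (Additive.ofMul b) = 0 := by
  rw [transgression_eq_iff]
  constructor
  · intro hχ b hb
    obtain ⟨ψ, hψ⟩ := hχ.exists_hom h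
    have hle : commutator X ≤ (AddMonoidHom.toMultiplicativeRight ψ).ker :=
      Abelianization.commutator_subset_ker _
    rw [← hψ]
    exact hle hb
  · intro hχ
    obtain ⟨ψ, hψ⟩ := exists_character_extension i χ hχ
    exact .of_hom ψ hψ

end IsCentralExtension

theorem mem_commutator_iff {G : Type} [Group G] {H : Subgroup G} (x : H) :
    x ∈ commutator H ↔ (x : G) ∈ ⁅H, H⁆ := by
  rw [← Subgroup.map_subtype_commutator]
  exact (Subgroup.mem_map_iff_mem H.subtype_injective).symm

theorem eq_one_of_mem_commutator {G : Type} [Group G] {A : Subgroup G}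
    (hA : ∀ a ∈ A, ∀ b ∈ A, Commute a b) {x : A} (hx : x ∈ commutator A) : x = 1 := by
  have h : ⁅A, A⁆ = ⊥ := Subgroup.commutator_eq_bot_iff_le_centralizer.2
    fun a ha => Subgroup.mem_centralizer_iff.2 fun b hb => (hA b hb a ha).eq
  rw [mem_commutator_iff, h] at hx
  exact Subtype.ext hx

theorem map_mem_commutator {X Y : Type*} [Group X] [Group Y] (f : X →* Y) {x : X}
    (hx : x ∈ commutator X) : f x ∈ commutator Y := by
  have := Subgroup.mem_map_of_mem f hx
  rw [commutator_def, Subgroup.map_commutator] at this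
  exact Subgroup.commutator_mono le_top le_top this

theorem isCentralExtension_subgroupOf {G : Type} [Group G] {H A : Subgroup G} (hAH : A ≤ H)
    [(A.subgroupOf H).Normal] (hA : ∀ a ∈ A, ∀ h ∈ H, Commute a h) :
    IsCentralExtension (Subgroup.inclusion hAH) (QuotientGroup.mk' (A.subgroupOf H)) where
  injective := Subgroup.inclusion_injective hAH
  surjective := QuotientGroup.mk'_surjective _
  map_eq_one_iff x := by
    rw [QuotientGroup.mk'_apply, QuotientGroup.eq_one_iff]
    exact ⟨fun hx => ⟨⟨x, hx⟩, rfl⟩, fun ⟨b, hb⟩ => hb ▸ b.2⟩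
  central b x := Subtype.ext (hA b b.2 x x.2)

section InflationKernel

variable {G : Type} [Group G] {H A Z : Subgroup G} {D : Type} [AddCommGroup D]
  [DivisibleBy D ℤ] [(A.subgroupOf H).Normal] [(Z.subgroupOf H).Normal]

theorem transgression_mem_ker_inflMap_iff (hAH : A ≤ H) (hA : ∀ a ∈ A, ∀ h ∈ H, Commute a h)
    (hZA : Z ≤ A) (hZ : Z ≤ ⁅H, H⁆) (χ : Additive A →+ D) :
    (isCentralExtension_subgroupOf hAH hA).transgression D χ ∈
        (inflMap (subgroupOf_le hZA H) D).ker ↔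
      ∀ z : A, (z : G) ∈ Z → χ (Additive.ofMul z) = 0 := by
  have hc := isCentralExtension_subgroupOf (hZA.trans hAH) fun a ha => hA a (hZA ha)
  have key : IsTransgression (Subgroup.inclusion (hZA.trans hAH))
      (QuotientGroup.mk' (Z.subgroupOf H))
      (χ.comp (MonoidHom.toAdditive (Subgroup.inclusion hZA)))
      (inflMap (subgroupOf_le hZA H) D
        ((isCentralExtension_subgroupOf hAH hA).transgression D χ)) := by
    obtain ⟨f, hf, φ, hfφ, hφ⟩ := (isCentralExtension_subgroupOf hAH hA).isTransgression χ
    rw [← hf]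
    exact ⟨pullCocycle (quotProj (subgroupOf_le hZA H)) f, rfl, φ, fun x y => hfφ x y,
      fun b x => hφ (Subgroup.inclusion hZA b) x⟩
  rw [AddMonoidHom.mem_ker, ← hc.transgression_eq_iff.2 key, hc.transgression_eq_zero_iff]
  exact ⟨fun h z hz => h ⟨z, hz⟩ ((mem_commutator_iff _).2 (hZ hz)),
    fun h b _ => h (Subgroup.inclusion hZA b) b.2⟩

theorem exists_transgression_of_mem_ker_inflMap (hAH : A ≤ H)
    (hA : ∀ a ∈ A, ∀ h ∈ H, Commute a h) (hZA : Z ≤ A) (hZ : Z ≤ ⁅H, H⁆)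
    {a : H2 (H ⧸ A.subgroupOf H) D} (ha : a ∈ (inflMap (subgroupOf_le hZA H) D).ker) :
    ∃ χ : Additive A →+ D, (∀ z : A, (z : G) ∈ Z → χ (Additive.ofMul z) = 0) ∧
      (isCentralExtension_subgroupOf hAH hA).transgression D χ = a := by
  have h0 : H2Map (QuotientGroup.mk' (A.subgroupOf H)) a = 0 := by
    have : H2Map (QuotientGroup.mk' (A.subgroupOf H)) a =
        H2Map (QuotientGroup.mk' (Z.subgroupOf H)) (inflMap (subgroupOf_le hZA H) D a) := by
      obtain ⟨f, rfl⟩ := H2mk_surjective a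
      rfl
    rw [this, (AddMonoidHom.mem_ker).1 ha, map_zero]
  obtain ⟨χ, hχ⟩ :=
    (isCentralExtension_subgroupOf hAH hA).exists_isTransgression_of_H2Map_eq_zero h0
  have hχa := (isCentralExtension_subgroupOf hAH hA).transgression_eq_iff.2 hχ
  exact ⟨χ, (transgression_mem_ker_inflMap_iff hAH hA hZA hZ χ).1 (hχa ▸ ha), hχa⟩

/-- The kernel of the inflation `H²(H/A, D) → H²(H/Z, D)` for `Z ≤ A ∩ [H, H]` and `A` central. -/
theorem nonempty_ker_inflMap_addEquiv (hAH : A ≤ H) (hA : ∀ a ∈ A, ∀ h ∈ H, Commute a h)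
    (hZA : Z ≤ A) (hZ : Z ≤ ⁅H, H⁆) [(Z.subgroupOf (A ⊓ ⁅H, H⁆)).Normal] :
    Nonempty ((inflMap (subgroupOf_le hZA H) D).ker ≃+
      (Additive (↥(A ⊓ ⁅H, H⁆) ⧸ Z.subgroupOf (A ⊓ ⁅H, H⁆)) →+ D)) := by
  let j : ↥(A ⊓ ⁅H, H⁆) →* A := Subgroup.inclusion inf_le_left
  let S : AddSubgroup (Additive A →+ D) :=
    (inflMap (subgroupOf_le hZA H) D).ker.comap
      ((isCentralExtension_subgroupOf hAH hA).transgression D)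
  have hS : ∀ χ : S, ∀ z : A, (z : G) ∈ Z → χ.1 (Additive.ofMul z) = 0 := fun χ =>
    (transgression_mem_ker_inflMap_iff hAH hA hZA hZ χ.1).1 χ.2
  let p : S →+ (inflMap (subgroupOf_le hZA H) D).ker :=
    (((isCentralExtension_subgroupOf hAH hA).transgression D).comp S.subtype).codRestrict _
      fun χ => χ.2
  let q : S →+ (Additive (↥(A ⊓ ⁅H, H⁆) ⧸ Z.subgroupOf (A ⊓ ⁅H, H⁆)) →+ D) :=
    AddMonoidHom.mk' (fun χ => MonoidHom.toAdditiveLeft (QuotientGroup.lift _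
      (AddMonoidHom.toMultiplicativeRight (χ.1.comp (MonoidHom.toAdditive j)))
      fun x hx => hS χ (j x) hx)) fun χ χ' => by
        ext x
        rfl
  have hq_eq : ∀ χ θ, q χ = θ ↔
      ∀ x, χ.1 (Additive.ofMul (j x)) = θ (Additive.ofMul (QuotientGroup.mk x)) := by
    refine fun χ θ => ⟨fun h x => h ▸ rfl, fun h => ?_⟩
    ext x
    exact h x
  refine nonempty_addEquiv_of_ker_eq p ?_ q ?_ fun χ => ?_
  · rintro ⟨a, ha⟩
    obtain ⟨χ, -, hχ⟩ := exists_transgression_of_mem_ker_inflMap hAH hA hZA hZ ha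
    refine ⟨⟨χ, ?_⟩, Subtype.ext hχ⟩
    rw [AddSubgroup.mem_comap, hχ]
    exact ha
  · intro θ
    obtain ⟨χ, hχ⟩ := exists_character_extension j
      (θ.comp (MonoidHom.toAdditive (QuotientGroup.mk' (Z.subgroupOf (A ⊓ ⁅H, H⁆)))))
      fun x hx => by
        have hx1 : x = 1 := Subgroup.inclusion_injective inf_le_left
          (eq_one_of_mem_commutator (fun a ha b hb => hA a ha b (hAH hb)) hx)
        rw [hx1, ofMul_one, map_zero]
    refine ⟨⟨χ, (transgression_mem_ker_inflMap_iff hAH hA hZA hZ χ).2 fun z hz => ?_⟩,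
      (hq_eq _ _).2 hχ⟩
    let x : ↥(A ⊓ ⁅H, H⁆) := ⟨z, z.2, hZ hz⟩
    have hx : (QuotientGroup.mk x : ↥(A ⊓ ⁅H, H⁆) ⧸ Z.subgroupOf (A ⊓ ⁅H, H⁆)) = 1 :=
      (QuotientGroup.eq_one_iff x).2 hz
    exact (hχ x).trans ((congrArg (fun y => θ (Additive.ofMul y)) hx).trans θ.map_zero)
  · rw [hq_eq, Subtype.ext_iff]
    refine (isCentralExtension_subgroupOf hAH hA).transgression_eq_zero_iff.trans ?_
    exact ⟨fun h x => h (j x) ((mem_commutator_iff _).2 x.2.2),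
      fun h b hb => h ⟨b, b.2, (mem_commutator_iff _).1 hb⟩⟩

end InflationKernel

section CentralProduct

variable {G : Type} [Group G] {H K : Subgroup G}

theorem exists_mul_eq_of_sup_eq_top [H.Normal] (hprod : H ⊔ K = ⊤) (g : G) :
    ∃ (h : H) (k : K), (h : G) * k = g := by
  obtain ⟨h, hh, k, hk, e⟩ := Subgroup.mem_sup_of_normal_left.1 (hprod ▸ Subgroup.mem_top g)
  exact ⟨⟨h, hh⟩, ⟨k, hk⟩, e⟩

/-- In a central product, functions on the factors that transform by the same additive character
of the intersection glue. -/
theorem exists_glued_cochain [H.Normal] (hprod : H ⊔ K = ⊤)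
    (hcomm : ∀ h ∈ H, ∀ k ∈ K, Commute h k) {D : Type} [AddCommGroup D] {φ : H → D} {ψ : K → D}
    {χ : Additive ↥(H ⊓ K) →+ D}
    (hφ : ∀ b x, φ (Subgroup.inclusion inf_le_left b * x) = χ (Additive.ofMul b) + φ x)
    (hψ : ∀ b x, ψ (Subgroup.inclusion inf_le_right b * x) = χ (Additive.ofMul b) + ψ x) :
    ∃ ω : G → D, ∀ (h : H) (k : K), ω (h * k) = φ h + ψ k := by
  choose u v huv using exists_mul_eq_of_sup_eq_top hprod
  refine ⟨fun g => φ (u g) + ψ (v g), fun h k => ?_⟩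
  have e := huv (h * k)
  change φ (u (h * k)) + ψ (v (h * k)) = _
  generalize u (h * k) = h' at *
  generalize v (h * k) = k' at *
  have e' : (h : G) * (h' : G)⁻¹ = k' * (k : G)⁻¹ := by
    have : (h : G) = h' * k' * (k : G)⁻¹ := by rw [e, mul_inv_cancel_right]
    rw [this, mul_assoc (h' : G) k', (hcomm h' h'.2 _ (K.mul_mem k'.2 (K.inv_mem k.2))).eq,
      mul_inv_cancel_right]
  let b : ↥(H ⊓ K) := ⟨h * (h' : G)⁻¹, H.mul_mem h.2 (H.inv_mem h'.2),
    e' ▸ K.mul_mem k'.2 (K.inv_mem k.2)⟩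
  have h1 : h = Subgroup.inclusion inf_le_left b * h' :=
    Subtype.ext (inv_mul_cancel_right _ _).symm
  have h2 : k' = Subgroup.inclusion inf_le_right b * k :=
    Subtype.ext (by
      change (k' : G) = h * (h' : G)⁻¹ * k
      rw [e', inv_mul_cancel_right])
  rw [h1, h2, hφ, hψ]
  abel

/-- The projection of a central product `G = HK` onto a quotient of `H` by a subgroup containing
`H ∩ K`. -/
theorem exists_projection [H.Normal] (hprod : H ⊔ K = ⊤)
    (hcomm : ∀ h ∈ H, ∀ k ∈ K, Commute h k) {A : Subgroup G} (hA : H ⊓ K ≤ A)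
    [(A.subgroupOf H).Normal] :
    ∃ P : G →* H ⧸ A.subgroupOf H, (∀ h : H, P h = QuotientGroup.mk h) ∧ ∀ k : K, P k = 1 := by
  let m : H × K →* G := MonoidHom.noncommCoprod H.subtype K.subtype
    fun h k => hcomm h h.2 k k.2
  have hm : Function.Surjective m := fun g => by
    obtain ⟨h, k, e⟩ := exists_mul_eq_of_sup_eq_top hprod g
    exact ⟨(h, k), e⟩
  let q : H × K →* H ⧸ A.subgroupOf H := (QuotientGroup.mk' _).comp (MonoidHom.fst H K)
  have hle : m.ker ≤ q.ker := by
    rintro ⟨h, k⟩ e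
    have e : (h : G) * k = 1 := e
    refine (QuotientGroup.eq_one_iff h).2 (hA ⟨h.2, ?_⟩)
    change (h : G) ∈ K
    rw [eq_inv_of_mul_eq_one_left e]
    exact K.inv_mem k.2
  have hP : ∀ x, m.liftOfSurjective hm ⟨q, hle⟩ (m x) = q x := fun x =>
    m.liftOfRightInverse_comp_apply _ (Function.rightInverse_surjInv hm) ⟨q, hle⟩ x
  refine ⟨m.liftOfSurjective hm ⟨q, hle⟩, fun h => ?_, fun k => ?_⟩
  · have := hP (h, 1)
    rwa [show m (h, 1) = h from mul_one _] at this
  · have := hP (1, k)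
    rwa [show m (1, k) = k from one_mul _,
      show q (1, k) = 1 from map_one (QuotientGroup.mk' _)] at this

theorem tmulAb_mul_left {X Y : Type} [Group X] [Group Y] (x x' : X) (y : Y) :
    tmulAb (x * x') y = tmulAb x y + tmulAb x' y := by
  rw [tmulAb, map_mul, ofMul_mul, TensorProduct.add_tmul]

theorem tmulAb_mul_right {X Y : Type} [Group X] [Group Y] (x : X) (y y' : Y) :
    tmulAb x (y * y') = tmulAb x y + tmulAb x y' := by
  rw [tmulAb, map_mul, ofMul_mul, TensorProduct.tmul_add]

theorem tmulAb_one_left {X Y : Type} [Group X] [Group Y] (y : Y) : tmulAb (1 : X) y = 0 := by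
  rw [tmulAb, map_one, ofMul_one, TensorProduct.zero_tmul]

/-- The homomorphism `Hom(X ⊗ Y, D) → H²(G, D)` sending a bilinear form to its pullback along
`P : G → X` and `Q : G → Y`. -/
noncomputable def pairingClass {X Y : Type} [Group X] [Group Y] (P : G →* X) (Q : G →* Y)
    (D : Type) [AddCommGroup D] : (AbTensor X Y →+ D) →+ H2 G D :=
  AddMonoidHom.mk' (fun β => H2mk ⟨fun x y => β (tmulAb (P x) (Q y)), fun x y z => by
      change β _ + β _ = β _ + β _
      rw [map_mul, map_mul, tmulAb_mul_left, tmulAb_mul_right, map_add, map_add]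
      abel⟩)
    fun _ _ => rfl

theorem eq_zero_of_tmulAb {X Y : Type} [Group X] [Group Y] {D : Type} [AddCommGroup D]
    {β : AbTensor X Y →+ D} (h : ∀ x y, β (tmulAb x y) = 0) : β = 0 := by
  refine AddMonoidHom.ext fun t => ?_
  induction t using TensorProduct.induction_on with
  | zero => simp
  | tmul x y =>
    obtain ⟨x, rfl⟩ := QuotientGroup.mk_surjective x
    obtain ⟨y, rfl⟩ := QuotientGroup.mk_surjective y
    exact h x y
  | add s t hs ht => rw [map_add, hs, ht]; simp

section Kernel

variable {D : Type} [AddCommGroup D]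
  [((H ⊓ K).subgroupOf H).Normal] [((H ⊓ K).subgroupOf K).Normal]
  {P : G →* H ⧸ (H ⊓ K).subgroupOf H} {Q : G →* K ⧸ (H ⊓ K).subgroupOf K}

theorem eq_zero_of_inflation_add_pairingClass_eq_zero
    (hcomm : ∀ h ∈ H, ∀ k ∈ K, Commute h k)
    (hPH : ∀ h : H, P h = QuotientGroup.mk h) (hPK : ∀ k : K, P k = 1)
    (hQH : ∀ h : H, Q h = 1) (hQK : ∀ k : K, Q k = QuotientGroup.mk k)
    {a : H2 (H ⧸ (H ⊓ K).subgroupOf H) D} {b : H2 (K ⧸ (H ⊓ K).subgroupOf K) D}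
    {β : AbTensor (H ⧸ (H ⊓ K).subgroupOf H) (K ⧸ (H ⊓ K).subgroupOf K) →+ D}
    (h : H2Map P a + H2Map Q b + pairingClass P Q D β = 0) : β = 0 := by
  obtain ⟨f, rfl⟩ := H2mk_surjective a
  obtain ⟨g, rfl⟩ := H2mk_surjective b
  obtain ⟨φ, hφ⟩ := H2mk_eq_zero_iff.1
    (show H2mk (pullCocycle P f + pullCocycle Q g + ⟨_, _⟩) = 0 from h)
  have hφ : ∀ x y, f.1 (P x) (P y) + g.1 (Q x) (Q y) + β (tmulAb (P x) (Q y)) =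
    φ x + φ y - φ (x * y) := hφ
  refine eq_zero_of_tmulAb fun x y => ?_
  obtain ⟨x, rfl⟩ := QuotientGroup.mk_surjective x
  obtain ⟨y, rfl⟩ := QuotientGroup.mk_surjective y
  have h := hφ y x
  rw [← (hcomm x x.2 y y.2).eq, add_comm (φ y), ← hφ x y, hPH, hPK, hQH, hQK,
    cocycle_one_left f x, cocycle_one_right f x, cocycle_one_left g y, cocycle_one_right g y,
    tmulAb_one_left, map_zero] at h
  exact (add_left_cancel h).symm

theorem inflation_add_eq_zero_iff [H.Normal] (hprod : H ⊔ K = ⊤)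
    (hcomm : ∀ h ∈ H, ∀ k ∈ K, Commute h k)
    (hPH : ∀ h : H, P h = QuotientGroup.mk h) (hPK : ∀ k : K, P k = 1)
    (hQH : ∀ h : H, Q h = 1) (hQK : ∀ k : K, Q k = QuotientGroup.mk k)
    (cH : IsCentralExtension (Subgroup.inclusion (inf_le_left : H ⊓ K ≤ H))
      (QuotientGroup.mk' ((H ⊓ K).subgroupOf H)))
    (cK : IsCentralExtension (Subgroup.inclusion (inf_le_right : H ⊓ K ≤ K))
      (QuotientGroup.mk' ((H ⊓ K).subgroupOf K)))
    (a : H2 (H ⧸ (H ⊓ K).subgroupOf H) D) (b : H2 (K ⧸ (H ⊓ K).subgroupOf K) D) :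
    H2Map P a + H2Map Q b = 0 ↔
      ∃ χ : Additive ↥(H ⊓ K) →+ D, cH.transgression D χ = a ∧ cK.transgression D χ = b := by
  simp only [IsCentralExtension.transgression_eq_iff]
  constructor
  · intro h
    obtain ⟨f, rfl⟩ := H2mk_surjective a
    obtain ⟨g, rfl⟩ := H2mk_surjective b
    obtain ⟨φ, hφ⟩ := H2mk_eq_zero_iff.1
      (show H2mk (pullCocycle P f + pullCocycle Q g) = 0 from h)
    have hφ : ∀ x y, f.1 (P x) (P y) + g.1 (Q x) (Q y) = φ x + φ y - φ (x * y) := hφ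
    have hfH : ∀ x y : H, f.1 (QuotientGroup.mk' _ x) (QuotientGroup.mk' _ y) =
        (φ x - g.1 1 1) + (φ y - g.1 1 1) - (φ ↑(x * y) - g.1 1 1) := fun x y => by
      have := hφ x y
      rw [hPH, hPH, hQH, hQH, ← eq_sub_iff_add_eq] at this
      rw [Subgroup.coe_mul, QuotientGroup.mk'_apply, QuotientGroup.mk'_apply, this]
      abel
    have hgK : ∀ x y : K, g.1 (QuotientGroup.mk' _ x) (QuotientGroup.mk' _ y) =
        (φ x - f.1 1 1) + (φ y - f.1 1 1) - (φ ↑(x * y) - f.1 1 1) := fun x y => by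
      have := hφ x y
      rw [hPK, hPK, hQK, hQK, ← eq_sub_iff_add_eq'] at this
      rw [Subgroup.coe_mul, QuotientGroup.mk'_apply, QuotientGroup.mk'_apply, this]
      abel
    obtain ⟨χ, hχ⟩ := cH.exists_character_of_cochain (φ := fun x : H => φ x - g.1 1 1) hfH
    exact ⟨χ, .of_cochain cH hfH hχ, .of_cochain cK (φ := fun x : K => φ x - f.1 1 1) hgK
      fun b => (hχ b).trans (sub_right_comm _ _ _)⟩
  · rintro ⟨χ, ⟨f, rfl, φ, hf, hφ⟩, ⟨g, rfl, ψ, hg, hψ⟩⟩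
    obtain ⟨ω, hω⟩ := exists_glued_cochain hprod hcomm hφ hψ
    change H2mk (pullCocycle P f + pullCocycle Q g) = 0
    refine H2mk_eq_zero_iff.2 ⟨ω, fun x y => ?_⟩
    obtain ⟨h, k, rfl⟩ := exists_mul_eq_of_sup_eq_top hprod x
    obtain ⟨h', k', rfl⟩ := exists_mul_eq_of_sup_eq_top hprod y
    have e : (h : G) * k * (h' * k') = ↑(h * h') * ↑(k * k') := by
      rw [Subgroup.coe_mul, Subgroup.coe_mul, mul_assoc, ← mul_assoc (k : G),
        ← (hcomm h' h'.2 k k.2).eq]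
      simp only [mul_assoc]
    change f.1 (P _) (P _) + g.1 (Q _) (Q _) = _
    rw [e, hω, hω, hω]
    simp only [map_mul, hPH, hPK, hQH, hQK, mul_one, one_mul]
    have h1 := hf h h'
    have h2 := hg k k'
    simp only [QuotientGroup.mk'_apply] at h1 h2
    rw [h1, h2]
    abel

end Kernel

/-- In a central product, a character of `H ∩ K` vanishing on `[H, H] ∩ [K, K]` is a product of
restrictions of characters of `H` and of `K`. -/
theorem exists_character_add {D : Type} [AddCommGroup D] [DivisibleBy D ℤ]
    (χ : Additive ↥(H ⊓ K) →+ D)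
    (hχ : ∀ z : ↥(H ⊓ K), (z : G) ∈ ⁅H, H⁆ ⊓ ⁅K, K⁆ → χ (Additive.ofMul z) = 0) :
    ∃ (ψH : Additive H →+ D) (ψK : Additive K →+ D), ∀ b : ↥(H ⊓ K),
      ψH (Additive.ofMul (Subgroup.inclusion inf_le_left b)) +
        ψK (Additive.ofMul (Subgroup.inclusion inf_le_right b)) = χ (Additive.ofMul b) := by
  obtain ⟨ψ, hψ⟩ := exists_character_extension
    ((Subgroup.inclusion (inf_le_left : H ⊓ K ≤ H)).prod
      (Subgroup.inclusion (inf_le_right : H ⊓ K ≤ K))) χ (fun z hz => by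
    refine hχ z ⟨(mem_commutator_iff _).1 (?_ : Subgroup.inclusion inf_le_left z ∈ commutator H),
      (mem_commutator_iff _).1 (?_ : Subgroup.inclusion inf_le_right z ∈ commutator K)⟩
    · exact map_mem_commutator (MonoidHom.fst H K) hz
    · exact map_mem_commutator (MonoidHom.snd H K) hz)
  refine ⟨ψ.comp (MonoidHom.toAdditive (MonoidHom.inl H K)),
    ψ.comp (MonoidHom.toAdditive (MonoidHom.inr H K)), fun b => ?_⟩
  rw [← hψ]
  change ψ _ + ψ _ = _
  rw [← map_add]
  congr 1
  exact congrArg Additive.ofMul (Prod.ext (mul_one _) (one_mul _))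

end CentralProduct

/-- **Theorem B (i).** With `L`, `M` the kernels of the inflation maps
`H²(H/A, D) → H²(H/Z, D)` and `H²(K/A, D) → H²(K/Z, D)`, one has
`L ≅ Hom((A ∩ H')/Z, D)`, `M ≅ Hom((A ∩ K')/Z, D)`, and there is a subgroup
`N ≅ Hom(Z, D)` of `H²(H/A, D)/L ⊕ H²(K/A, D)/M` such that
`((H²(H/A, D)/L ⊕ H²(K/A, D)/M)/N) ⊕ Hom(H/A ⊗ K/A, D)` embeds in `H²(G, D)`. -/
theorem theoremB_i {G : Type} [Group G] (H K : Subgroup G) [H.Normal] [K.Normal]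
    (hprod : H ⊔ K = ⊤) (hcomm : ∀ h ∈ H, ∀ k ∈ K, Commute h k)
    (D : Type) [AddCommGroup D] [DivisibleBy D ℤ]
    [((H ⊓ K).subgroupOf H).Normal] [((H ⊓ K).subgroupOf K).Normal]
    [((⁅H, H⁆ ⊓ ⁅K, K⁆).subgroupOf H).Normal] [((⁅H, H⁆ ⊓ ⁅K, K⁆).subgroupOf K).Normal]
    [((⁅H, H⁆ ⊓ ⁅K, K⁆).subgroupOf (H ⊓ K ⊓ ⁅H, H⁆)).Normal]
    [((⁅H, H⁆ ⊓ ⁅K, K⁆).subgroupOf (H ⊓ K ⊓ ⁅K, K⁆)).Normal] :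
    let L := AddMonoidHom.ker (inflMap (subgroupOf_le (inf_commutator_le_inf H K) H) D)
    let M := AddMonoidHom.ker (inflMap (subgroupOf_le (inf_commutator_le_inf H K) K) D)
    Nonempty (↥L ≃+
      (Additive (↥(H ⊓ K ⊓ ⁅H, H⁆) ⧸ (⁅H, H⁆ ⊓ ⁅K, K⁆).subgroupOf (H ⊓ K ⊓ ⁅H, H⁆)) →+ D)) ∧
    Nonempty (↥M ≃+
      (Additive (↥(H ⊓ K ⊓ ⁅K, K⁆) ⧸ (⁅H, H⁆ ⊓ ⁅K, K⁆).subgroupOf (H ⊓ K ⊓ ⁅K, K⁆)) →+ D)) ∧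
    ∃ N : AddSubgroup
        ((H2 (↥H ⧸ (H ⊓ K).subgroupOf H) D ⧸ L) × (H2 (↥K ⧸ (H ⊓ K).subgroupOf K) D ⧸ M)),
      Nonempty (↥N ≃+ (Additive ↥(⁅H, H⁆ ⊓ ⁅K, K⁆) →+ D)) ∧
      ∃ ι : ((((H2 (↥H ⧸ (H ⊓ K).subgroupOf H) D ⧸ L) ×
              (H2 (↥K ⧸ (H ⊓ K).subgroupOf K) D ⧸ M)) ⧸ N) ×
            (AbTensor (↥H ⧸ (H ⊓ K).subgroupOf H) (↥K ⧸ (H ⊓ K).subgroupOf K) →+ D)) →+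
          H2 G D,
        Function.Injective ι := by
  intro L M
  have hZ : ⁅H, H⁆ ⊓ ⁅K, K⁆ ≤ H ⊓ K := inf_commutator_le_inf H K
  have hAH : ∀ a ∈ H ⊓ K, ∀ h ∈ H, Commute a h := fun a ha h hh => (hcomm h hh a ha.2).symm
  have hAK : ∀ a ∈ H ⊓ K, ∀ k ∈ K, Commute a k := fun a ha k hk => hcomm a ha.1 k hk
  refine ⟨nonempty_ker_inflMap_addEquiv inf_le_left hAH hZ inf_le_left,
    nonempty_ker_inflMap_addEquiv inf_le_right hAK hZ inf_le_right, ?_⟩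
  have cH := isCentralExtension_subgroupOf (inf_le_left : H ⊓ K ≤ H) hAH
  have cK := isCentralExtension_subgroupOf (inf_le_right : H ⊓ K ≤ K) hAK
  have hL : ∀ χ : Additive ↥(H ⊓ K) →+ D, cH.transgression D χ ∈ L ↔ _ :=
    transgression_mem_ker_inflMap_iff inf_le_left hAH hZ inf_le_left
  have hM : ∀ χ : Additive ↥(H ⊓ K) →+ D, cK.transgression D χ ∈ M ↔ _ :=
    transgression_mem_ker_inflMap_iff inf_le_right hAK hZ inf_le_right
  have hL' : ∀ a ∈ L, ∃ χ, cH.transgression D χ = a ∧ cK.transgression D χ = 0 := by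
    intro a ha
    obtain ⟨χ, hχ, rfl⟩ :=
      exists_transgression_of_mem_ker_inflMap inf_le_left hAH hZ inf_le_left ha
    obtain ⟨ψH, ψK, hψ⟩ := exists_character_add χ hχ
    have h1 := cH.transgression_eq_iff.2 (.of_hom (χ := ψH.comp (MonoidHom.toAdditive
      (Subgroup.inclusion inf_le_left))) ψH fun _ => rfl)
    have h2 := cK.transgression_eq_iff.2 (.of_hom (χ := ψK.comp (MonoidHom.toAdditive
      (Subgroup.inclusion inf_le_right))) ψK fun _ => rfl)
    refine ⟨_, ?_, h2⟩
    rw [← zero_add (cH.transgression D _), ← h1, ← map_add]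
    exact congrArg _ (AddMonoidHom.ext hψ)
  have hM' : ∀ b ∈ M, ∃ χ, cH.transgression D χ = 0 ∧ cK.transgression D χ = b := by
    intro b hb
    obtain ⟨χ, hχ, rfl⟩ :=
      exists_transgression_of_mem_ker_inflMap inf_le_right hAK hZ inf_le_right hb
    obtain ⟨ψH, ψK, hψ⟩ := exists_character_add χ hχ
    have h1 := cH.transgression_eq_iff.2 (.of_hom (χ := ψH.comp (MonoidHom.toAdditive
      (Subgroup.inclusion inf_le_left))) ψH fun _ => rfl)
    have h2 := cK.transgression_eq_iff.2 (.of_hom (χ := ψK.comp (MonoidHom.toAdditive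
      (Subgroup.inclusion inf_le_right))) ψK fun _ => rfl)
    refine ⟨_, h1, ?_⟩
    rw [← add_zero (cK.transgression D _), ← h2, ← map_add]
    exact congrArg _ (AddMonoidHom.ext hψ)
  let τ : (Additive ↥(H ⊓ K) →+ D) →+
      (H2 (↥H ⧸ (H ⊓ K).subgroupOf H) D ⧸ L) × (H2 (↥K ⧸ (H ⊓ K).subgroupOf K) D ⧸ M) :=
    ((QuotientAddGroup.mk' L).comp (cH.transgression D)).prod
      ((QuotientAddGroup.mk' M).comp (cK.transgression D))
  refine ⟨τ.range, ?_, ?_⟩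
  · let res : (Additive ↥(H ⊓ K) →+ D) →+ (Additive ↥(⁅H, H⁆ ⊓ ⁅K, K⁆) →+ D) :=
      AddMonoidHom.mk' (fun χ => χ.comp (MonoidHom.toAdditive (Subgroup.inclusion hZ)))
        fun _ _ => rfl
    refine nonempty_addEquiv_of_ker_eq τ.rangeRestrict τ.rangeRestrict_surjective res ?_
      fun χ => ?_
    · intro θ
      obtain ⟨χ, hχ⟩ := exists_character_extension (Subgroup.inclusion hZ) θ fun x hx => by
        have hx1 : x = 1 := Subgroup.inclusion_injective hZ
          (eq_one_of_mem_commutator (fun a ha b hb => hAH a ha b hb.1) hx)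
        rw [hx1, ofMul_one, map_zero]
      exact ⟨χ, AddMonoidHom.ext hχ⟩
    · have : τ χ = 0 ↔ cH.transgression D χ ∈ L ∧ cK.transgression D χ ∈ M :=
        Prod.ext_iff.trans (and_congr (QuotientAddGroup.eq_zero_iff _)
          (QuotientAddGroup.eq_zero_iff _))
      rw [Subtype.ext_iff]
      refine this.trans ?_
      rw [hL, hM, and_self, DFunLike.ext_iff]
      exact ⟨fun h z => h (Subgroup.inclusion hZ z) z.2, fun h z hz => h ⟨z, hz⟩⟩
  · obtain ⟨P, hPH, hPK⟩ := exists_projection hprod hcomm le_rfl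
    obtain ⟨Q, hQK, hQH⟩ := exists_projection (sup_comm H K ▸ hprod)
      (fun k hk h hh => (hcomm h hh k hk).symm) (inf_comm K H).le
    let p := ((QuotientAddGroup.mk' τ.range).comp
      ((QuotientAddGroup.mk' L).prodMap (QuotientAddGroup.mk' M))).prodMap (AddMonoidHom.id
        (AbTensor (↥H ⧸ (H ⊓ K).subgroupOf H) (↥K ⧸ (H ⊓ K).subgroupOf K) →+ D))
    let Φ := ((H2Map (D := D) P).coprod (H2Map Q)).coprod (pairingClass P Q D)
    have hp : Function.Surjective p := by
      refine Function.Surjective.prodMap ((QuotientAddGroup.mk'_surjective _).comp ?_)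
        Function.surjective_id
      exact (QuotientAddGroup.mk'_surjective _).prodMap (QuotientAddGroup.mk'_surjective _)
    obtain ⟨ι, hι, -⟩ := exists_injective_comp_eq p hp Φ (by
      rintro ⟨⟨a, b⟩, β⟩
      have hp0 : p ((a, b), β) = 0 ↔ (∃ χ, τ χ = (QuotientAddGroup.mk a, QuotientAddGroup.mk b)) ∧
          β = 0 := Prod.ext_iff.trans (and_congr (QuotientAddGroup.eq_zero_iff _) Iff.rfl)
      have hΦ : Φ ((a, b), β) = H2Map P a + H2Map Q b + pairingClass P Q D β := rfl
      have hβ : Φ ((a, b), β) = 0 ↔ H2Map P a + H2Map Q b = 0 ∧ β = 0 := by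
        rw [hΦ]
        refine ⟨fun h => ?_, fun h => by rw [h.1, h.2, map_zero, add_zero]⟩
        have := eq_zero_of_inflation_add_pairingClass_eq_zero hcomm hPH hPK hQH hQK h
        rw [this, map_zero, add_zero] at h
        exact ⟨h, this⟩
      rw [hp0, hβ, inflation_add_eq_zero_iff hprod hcomm hPH hPK hQH hQK cH cK]
      refine and_congr_left fun _ => ⟨?_, ?_⟩
      · rintro ⟨χ, hχ⟩
        obtain ⟨χ₁, h1, h1'⟩ := hL' _ (QuotientAddGroup.eq.1 (congrArg Prod.fst hχ))
        obtain ⟨χ₂, h2, h2'⟩ := hM' _ (QuotientAddGroup.eq.1 (congrArg Prod.snd hχ))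
        refine ⟨χ + χ₁ + χ₂, ?_, ?_⟩
        · rw [map_add, map_add, h1, h2, add_zero, add_neg_cancel_left]
        · rw [map_add, map_add, h1', h2', add_zero, add_neg_cancel_left]
      · rintro ⟨χ, rfl, rfl⟩
        exact ⟨χ, rfl⟩)
    exact ⟨ι, hι⟩

end SchurCP
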